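/- Let S be a countably based Cu-semigroup. Then S is inf-semilattice ordered if and only if S has the Riesz Interpolation Property and satisfies the interval axiom. -/

import Mathlib

variable {S : Type*} [AddCommMonoid S] [PartialOrder S]

/-- The (sequential) way-below relation: `x ≪ y` if for every increasing sequence whose
supremum dominates `y`, some member of the sequence dominates `x`. -/
def WayBelow (x y : S) : Prop :=
  ∀ f : ℕ → S, Monotone f → ∀ s : S, IsLUB (Set.range f) s → y ≤ s → ∃ n, x ≤ f n

/-- A Cu-semigroup (abstract Cuntz semigroup): a positively ordered commutative monoid
satisfying the axioms (O1)-(O4). -/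
structure IsCuSemigroup (S : Type*) [AddCommMonoid S] [PartialOrder S] : Prop where
  zero_le : ∀ x : S, 0 ≤ x
  add_le_add : ∀ {a b c d : S}, a ≤ b → c ≤ d → a + c ≤ b + d
  O1 : ∀ f : ℕ → S, Monotone f → ∃ s : S, IsLUB (Set.range f) s
  O2 : ∀ x : S, ∃ f : ℕ → S, (∀ n, WayBelow (f n) (f (n + 1))) ∧ IsLUB (Set.range f) x
  O3 : ∀ {x' x y' y : S}, WayBelow x' x → WayBelow y' y → WayBelow (x' + y') (x + y)
  O4 : ∀ f g : ℕ → S, Monotone f → Monotone g → ∀ s t : S, IsLUB (Set.range f) s →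
    IsLUB (Set.range g) t → IsLUB (Set.range fun n => f n + g n) (s + t)

/-- Axiom (O5) for Cu-semigroups. -/
def AxiomO5 (S : Type*) [AddCommMonoid S] [PartialOrder S] : Prop :=
  ∀ x' x y' y z : S, x + y ≤ z → WayBelow x' x → WayBelow y' y →
    ∃ c : S, x' + c ≤ z ∧ z ≤ x + c ∧ WayBelow y' c

/-- Axiom (O6) for Cu-semigroups. -/
def AxiomO6 (S : Type*) [AddCommMonoid S] [PartialOrder S] : Prop :=
  ∀ x' x y z : S, WayBelow x' x → x ≤ y + z →
    ∃ e f : S, x' ≤ e + f ∧ e ≤ x ∧ e ≤ y ∧ f ≤ x ∧ f ≤ z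

/-- Axiom (O8) for Cu-semigroups. -/
def AxiomO8 (S : Type*) [AddCommMonoid S] [PartialOrder S] : Prop :=
  ∀ x' x y' y z w : S, 2 • w = w → WayBelow (x + y) (z + w) → WayBelow x' x → WayBelow y' y →
    ∃ z₁ z₂ : S, WayBelow (z₁ + z₂) z ∧ WayBelow x' (z₁ + w) ∧ WayBelow y' (z₂ + w) ∧
      WayBelow z₁ (x + w) ∧ WayBelow z₂ (y + w)

/-- A Cu-semigroup is weakly cancellative if `x + z ≪ y + z` implies `x ≪ y`. -/
def WeaklyCancellative (S : Type*) [AddCommMonoid S] [PartialOrder S] : Prop :=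
  ∀ x y z : S, WayBelow (x + z) (y + z) → WayBelow x y

/-- An element `x` is weakly `(k,ω)`-divisible. -/
def IsWeaklyDivisible (k : ℕ) (x : S) : Prop :=
  ∀ x' : S, WayBelow x' x → ∃ (n : ℕ) (y : Fin n → S),
    (∀ j, k • y j ≤ x) ∧ x' ≤ ∑ j, y j

/-- An element `x` is `(k,ω)`-divisible. -/
def IsDivisible (k : ℕ) (x : S) : Prop :=
  ∀ x' : S, WayBelow x' x → ∃ (n : ℕ) (y : S), k • y ≤ x ∧ x' ≤ n • y

/-- The interval axiom for Cu-semigroups. -/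
def IntervalAxiom (S : Type*) [AddCommMonoid S] [PartialOrder S] : Prop :=
  ∀ x' x y u v : S, WayBelow x' x → WayBelow x (y + u) → WayBelow x (y + v) →
    ∃ w : S, WayBelow x' (y + w) ∧ WayBelow w u ∧ WayBelow w v

/-- The Riesz Interpolation Property. -/
def RieszInterpolation (S : Type*) [AddCommMonoid S] [PartialOrder S] : Prop :=
  ∀ x₁ x₂ y₁ y₂ : S, x₁ ≤ y₁ → x₁ ≤ y₂ → x₂ ≤ y₁ → x₂ ≤ y₂ →
    ∃ z : S, x₁ ≤ z ∧ x₂ ≤ z ∧ z ≤ y₁ ∧ z ≤ y₂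

/-- A Cu-semigroup is countably based if there is a countable subset such that every
element is the supremum of an increasing sequence from that subset. -/
def CountablyBased (S : Type*) [AddCommMonoid S] [PartialOrder S] : Prop :=
  ∃ B : Set S, B.Countable ∧ ∀ x : S, ∃ f : ℕ → S,
    Monotone f ∧ (∀ n, f n ∈ B) ∧ IsLUB (Set.range f) x

/-- A Cu-semigroup is inf-semilattice ordered if finite infima exist and addition
distributes over them. -/
def InfSemilatticeOrdered (S : Type*) [AddCommMonoid S] [PartialOrder S] : Prop :=
  (∀ x y : S, ∃ m : S, IsGLB {x, y} m) ∧
    ∀ x y z m : S, IsGLB {x, y} m → IsGLB {x + z, y + z} (m + z)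

namespace WayBelow

theorem le {P : Type*} [PartialOrder P] {x y : P} (h : WayBelow x y) : x ≤ y := by
  obtain ⟨_, hn⟩ := h (fun _ => y) monotone_const y (by simp) le_rfl
  exact hn

theorem trans_le {P : Type*} [PartialOrder P] {x y z : P} (h : WayBelow x y) (hyz : y ≤ z) :
    WayBelow x z :=
  fun f hf s hs hz => h f hf s hs (hyz.trans hz)

theorem le_trans {P : Type*} [PartialOrder P] {x y z : P} (hxy : x ≤ y) (h : WayBelow y z) :
    WayBelow x z :=
  fun f hf s hs hz => (h f hf s hs hz).imp fun _ hn => hxy.trans hn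

end WayBelow

namespace IsCuSemigroup

theorem zero_wayBelow (hS : IsCuSemigroup S) (x : S) : WayBelow 0 x :=
  fun f _ _ _ _ => ⟨0, hS.zero_le (f 0)⟩

/-- Every element is the supremum of an increasing sequence of elements way below it. -/
theorem exists_seq (hS : IsCuSemigroup S) (x : S) :
    ∃ f : ℕ → S, Monotone f ∧ (∀ n, WayBelow (f n) (f (n + 1))) ∧ (∀ n, WayBelow (f n) x) ∧
      IsLUB (Set.range f) x := by
  obtain ⟨f, hf, hx⟩ := hS.O2 x
  exact ⟨f, monotone_nat_of_le_succ fun n => (hf n).le, hf,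
    fun n => (hf n).trans_le (hx.1 ⟨n + 1, rfl⟩), hx⟩

theorem le_of_forall_wayBelow (hS : IsCuSemigroup S) {x y : S}
    (h : ∀ x', WayBelow x' x → x' ≤ y) : x ≤ y := by
  obtain ⟨f, -, -, hfx, hx⟩ := hS.exists_seq x
  exact hx.2 (Set.forall_mem_range.2 fun n => h _ (hfx n))

theorem wayBelow_interpolate (hS : IsCuSemigroup S) {x y : S} (h : WayBelow x y) :
    ∃ z, WayBelow x z ∧ WayBelow z y := by
  obtain ⟨f, hm, hf, hfy, hy⟩ := hS.exists_seq y
  obtain ⟨n, hn⟩ := h f hm y hy le_rfl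
  exact ⟨f (n + 1), .le_trans hn (hf n), hfy _⟩

theorem exists_wayBelow_of_wayBelow_of_wayBelow (hS : IsCuSemigroup S) {a b x : S}
    (ha : WayBelow a x) (hb : WayBelow b x) : ∃ z, a ≤ z ∧ b ≤ z ∧ WayBelow z x := by
  obtain ⟨f, hm, -, hfx, hx⟩ := hS.exists_seq x
  obtain ⟨i, hi⟩ := ha f hm x hx le_rfl
  obtain ⟨j, hj⟩ := hb f hm x hx le_rfl
  exact ⟨f (max i j), hi.trans (hm (le_max_left _ _)), hj.trans (hm (le_max_right _ _)), hfx _⟩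

/-- With Riesz interpolation, the elements way below both `x` and `y` are upward directed. -/
theorem exists_wayBelow_both (hS : IsCuSemigroup S) (hR : RieszInterpolation S) {x y a b : S}
    (ha : WayBelow a x ∧ WayBelow a y) (hb : WayBelow b x ∧ WayBelow b y) :
    ∃ z, (WayBelow z x ∧ WayBelow z y) ∧ a ≤ z ∧ b ≤ z := by
  obtain ⟨x', hax, hbx, hx⟩ := hS.exists_wayBelow_of_wayBelow_of_wayBelow ha.1 hb.1
  obtain ⟨y', hay, hby, hy⟩ := hS.exists_wayBelow_of_wayBelow_of_wayBelow ha.2 hb.2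
  obtain ⟨z, haz, hbz, hzx, hzy⟩ := hR a b x' y' hax hay hbx hby
  exact ⟨z, ⟨.le_trans hzx hx, .le_trans hzy hy⟩, haz, hbz⟩

/-- In a countably based Cu-semigroup, a nonempty directed lower set has a supremum. -/
theorem exists_isLUB_of_directed (hS : IsCuSemigroup S) (hcb : CountablyBased S) {L : Set S}
    (hne : L.Nonempty) (hlow : IsLowerSet L) (hdir : ∀ a ∈ L, ∀ b ∈ L, ∃ c ∈ L, a ≤ c ∧ b ≤ c) :
    ∃ s, IsLUB L s := by
  obtain ⟨B, hB, hBS⟩ := hcb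
  have happrox : ∀ z ∈ L, ∃ f : ℕ → S, (∀ n, f n ∈ B ∩ L) ∧ IsLUB (Set.range f) z := by
    intro z hz
    obtain ⟨f, -, hfB, hf⟩ := hBS z
    exact ⟨f, fun n => ⟨hfB n, hlow (hf.1 ⟨n, rfl⟩) hz⟩, hf⟩
  obtain ⟨z₀, hz₀⟩ := hne
  obtain ⟨f₀, hf₀, -⟩ := happrox z₀ hz₀
  obtain ⟨e, he⟩ := (hB.mono Set.inter_subset_left).exists_eq_range ⟨f₀ 0, hf₀ 0⟩
  have heL (n : ℕ) : e n ∈ L := (he.symm.subset ⟨n, rfl⟩ : e n ∈ B ∩ L).2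
  choose! c hcL hc₁ hc₂ using hdir
  let g : ℕ → S := fun n => Nat.rec (e 0) (fun n a => c a (e n)) n
  have hgL (n : ℕ) : g n ∈ L := Nat.rec (heL 0) (fun n h => hcL _ h _ (heL n)) n
  obtain ⟨s, hs⟩ := hS.O1 g (monotone_nat_of_le_succ fun n => hc₁ _ (hgL n) _ (heL n))
  refine ⟨s, fun z hz => ?_, fun t ht => hs.2 (Set.forall_mem_range.2 fun n => ht (hgL n))⟩
  obtain ⟨f, hf, hfz⟩ := happrox z hz
  refine hfz.2 (Set.forall_mem_range.2 fun n => ?_)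
  obtain ⟨k, hk⟩ := he.subset (hf n)
  exact hk ▸ (hc₂ _ (hgL k) _ (heL k)).trans (hs.1 ⟨k + 1, rfl⟩)

theorem exists_isGLB (hS : IsCuSemigroup S) (hcb : CountablyBased S) (hR : RieszInterpolation S)
    (x y : S) : ∃ m, IsGLB {x, y} m := by
  obtain ⟨s, hs⟩ := hS.exists_isLUB_of_directed hcb (L := {z | WayBelow z x ∧ WayBelow z y})
    ⟨0, hS.zero_wayBelow x, hS.zero_wayBelow y⟩
    (fun a b hba ha => ⟨.le_trans hba ha.1, .le_trans hba ha.2⟩)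
    (fun a ha b hb => hS.exists_wayBelow_both hR ha hb)
  refine ⟨s, ?_, fun t ht => hS.le_of_forall_wayBelow fun t' ht' => hs.1 ?_⟩
  · rintro _ (rfl | rfl)
    exacts [hs.2 fun z hz => hz.1.le, hs.2 fun z hz => hz.2.le]
  · exact ⟨ht'.trans_le (ht (by simp)), ht'.trans_le (ht (by simp))⟩

theorem isGLB_add_right (hS : IsCuSemigroup S) (hI : IntervalAxiom S) {x y m : S} (z : S)
    (hm : IsGLB {x, y} m) : IsGLB {x + z, y + z} (m + z) := by
  refine ⟨?_, fun t ht => hS.le_of_forall_wayBelow fun t' ht' => ?_⟩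
  · rintro _ (rfl | rfl)
    exacts [hS.add_le_add (hm.1 (by simp)) le_rfl, hS.add_le_add (hm.1 (by simp)) le_rfl]
  · obtain ⟨t'', h₁, h₂⟩ := hS.wayBelow_interpolate ht'
    obtain ⟨w, hw, hwx, hwy⟩ := hI t' t'' z x y h₁
      (add_comm x z ▸ h₂.trans_le (ht (by simp))) (add_comm y z ▸ h₂.trans_le (ht (by simp)))
    have hwm : w ≤ m := hm.2 (by rintro _ (rfl | rfl); exacts [hwx.le, hwy.le])
    exact add_comm z m ▸ hw.le.trans (hS.add_le_add le_rfl hwm)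

end IsCuSemigroup

namespace InfSemilatticeOrdered

theorem rieszInterpolation (h : InfSemilatticeOrdered S) : RieszInterpolation S := by
  intro x₁ x₂ y₁ y₂ h₁₁ h₁₂ h₂₁ h₂₂
  obtain ⟨m, hm⟩ := h.1 y₁ y₂
  refine ⟨m, hm.2 ?_, hm.2 ?_, hm.1 (by simp), hm.1 (by simp)⟩ <;> rintro _ (rfl | rfl) <;>
    assumption

theorem intervalAxiom (h : InfSemilatticeOrdered S) (hS : IsCuSemigroup S) :
    IntervalAxiom S := by
  intro x' x y u v hx hu hv
  obtain ⟨m, hm⟩ := h.1 u v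
  have hxm : x ≤ y + m := by
    rw [add_comm]
    refine (h.2 u v y m hm).2 ?_
    rintro _ (rfl | rfl)
    exacts [add_comm y u ▸ hu.le, add_comm y v ▸ hv.le]
  obtain ⟨x'', h₁, h₂⟩ := hS.wayBelow_interpolate hx
  obtain ⟨w, hw, -, hwm, hlub⟩ := hS.exists_seq m
  obtain ⟨n, hn⟩ := h₂ (fun n => y + w n) (fun i j hij => hS.add_le_add le_rfl (hw hij)) (y + m)
    (hS.O4 (fun _ => y) w monotone_const hw y m (by simp) hlub) hxm
  exact ⟨w n, h₁.trans_le hn, (hwm n).trans_le (hm.1 (by simp)), (hwm n).trans_le (hm.1 (by simp))⟩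

end InfSemilatticeOrdered

theorem infSemilatticeOrdered_iff (S : Type*) [AddCommMonoid S] [PartialOrder S]
    (hS : IsCuSemigroup S) (hcb : CountablyBased S) :
    InfSemilatticeOrdered S ↔ RieszInterpolation S ∧ IntervalAxiom S :=
  ⟨fun h => ⟨h.rieszInterpolation, h.intervalAxiom hS⟩,
    fun h => ⟨hS.exists_isGLB hcb h.1, fun _ _ z _ hm => hS.isGLB_add_right h.2 z hm⟩⟩
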